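/- arXiv:1905.01502 — 8 statements merged into one kernel-verified Lean document; each statement's English description precedes it below -/
import Mathlib

section
/- Let (A_j)_{j=1,…,m} be a partition of the closed unit ball B of ℝ^d such that every A_j has nonempty interior and r_{A_j} < r ≤ 16·m^{−1/d} for some r > 0, where r_A := inf{ρ > 0 : ∃ z ∈ B such that A ⊆ B_ρ(z)}. Let X ⊆ B and η : X → [0,1], and assume X₀ = ∂_X X₁ = ∂_X X₋₁, where ∂_X denotes the boundary relative to X. Then for every s ≥ r, every point of X belongs to N^s ∪ F^s. -/
open Set Metric MeasureTheory ENNReal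

open Classical in
/-- The distance to the decision boundary `Δ_η` associated to a posterior probability
`η` on `X`: for `x ∈ X₁` it is the (extended) distance to `X₋₁`, for `x ∈ X₋₁` the
distance to `X₁`, and `0` otherwise. -/
noncomputable def deltaEta {E : Type*} [PseudoEMetricSpace E]
    (X : Set E) (η : E → ℝ) (x : E) : ℝ≥0∞ :=
  if x ∈ X ∧ 1/2 < η x then EMetric.infEdist x {y ∈ X | η y < 1/2}
  else if x ∈ X ∧ η x < 1/2 then EMetric.infEdist x {y ∈ X | 1/2 < η y}
  else 0

/-- The boundary of `S` relative to `X` (for `S ⊆ X`). -/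
def relBoundary {E : Type*} [TopologicalSpace E] (X S : Set E) : Set E :=
  X ∩ closure S ∩ closure (X \ S)

theorem deltaEta_of_gt {E : Type*} [PseudoEMetricSpace E] {X : Set E} {η : E → ℝ} {x : E}
    (hx : x ∈ X) (h : 1/2 < η x) : deltaEta X η x = infEDist x {y ∈ X | η y < 1/2} :=
  if_pos ⟨hx, h⟩

theorem deltaEta_of_lt {E : Type*} [PseudoEMetricSpace E] {X : Set E} {η : E → ℝ} {x : E}
    (hx : x ∈ X) (h : η x < 1/2) : deltaEta X η x = infEDist x {y ∈ X | 1/2 < η y} :=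
  (if_neg fun h' ↦ h.not_gt h'.2).trans (if_pos ⟨hx, h⟩)

/-- If the level set `η = 1/2` lies in the closure of both `X₁` and `X₋₁`, then the distance to
the decision boundary is 1-Lipschitz on `X`. -/
theorem deltaEta_le_deltaEta_add_edist {E : Type*} [PseudoEMetricSpace E] {X : Set E} {η : E → ℝ}
    (h₁ : {x ∈ X | η x = 1/2} ⊆ closure {x ∈ X | 1/2 < η x})
    (h₂ : {x ∈ X | η x = 1/2} ⊆ closure {x ∈ X | η x < 1/2})
    {x y : E} (hx : x ∈ X) (hy : y ∈ X) :
    deltaEta X η x ≤ deltaEta X η y + edist x y := by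
  have key : ∀ {S : Set E}, y ∈ closure S → infEDist x S ≤ edist x y := fun h ↦ by
    rw [← infEDist_closure]; exact infEDist_le_edist_of_mem h
  rcases lt_trichotomy (η x) (1/2) with hx' | hx' | hx'
  · rw [deltaEta_of_lt hx hx']
    rcases lt_trichotomy (η y) (1/2) with hy' | hy' | hy'
    · rw [deltaEta_of_lt hy hy']
      exact infEDist_le_infEDist_add_edist
    · exact le_add_of_le_right (key (h₁ ⟨hy, hy'⟩))
    · exact le_add_of_le_right (key (subset_closure ⟨hy, hy'⟩))
  · simp [deltaEta, hx']
  · rw [deltaEta_of_gt hx hx']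
    rcases lt_trichotomy (η y) (1/2) with hy' | hy' | hy'
    · exact le_add_of_le_right (key (subset_closure ⟨hy, hy'⟩))
    · exact le_add_of_le_right (key (h₂ ⟨hy, hy'⟩))
    · rw [deltaEta_of_gt hy hy']
      exact infEDist_le_infEDist_add_edist

theorem statement0
    (d m : ℕ) (hd : 1 ≤ d) (hm : 1 ≤ m)
    (A : Fin m → Set (EuclideanSpace ℝ (Fin d)))
    (hcover : (⋃ j, A j) = closedBall (0 : EuclideanSpace ℝ (Fin d)) 1)
    (hdisj : Pairwise (Function.onFun Disjoint A))
    (hint : ∀ j, (interior (A j)).Nonempty)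
    (r : ℝ) (hr : 0 < r)
    (hrad : ∀ j, sInf {ρ : ℝ | 0 < ρ ∧
        ∃ z ∈ closedBall (0 : EuclideanSpace ℝ (Fin d)) 1, A j ⊆ closedBall z ρ} < r)
    (hrm : r ≤ 16 * (m : ℝ) ^ (-(1 : ℝ) / (d : ℝ)))
    (X : Set (EuclideanSpace ℝ (Fin d))) (hXB : X ⊆ closedBall 0 1)
    (η : EuclideanSpace ℝ (Fin d) → ℝ) (hη : ∀ x ∈ X, η x ∈ Icc (0 : ℝ) 1)
    (hbd1 : {x ∈ X | η x = 1/2} = relBoundary X {x ∈ X | 1/2 < η x})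
    (hbd2 : {x ∈ X | η x = 1/2} = relBoundary X {x ∈ X | η x < 1/2})
    (s : ℝ) (hs : r ≤ s) :
    X ⊆ (⋃ j ∈ {j : Fin m | ∀ x ∈ A j ∩ X, deltaEta X η x ≤ ENNReal.ofReal (3 * s)}, A j)
        ∪ (⋃ j ∈ {j : Fin m | ∀ x ∈ A j ∩ X, ENNReal.ofReal s ≤ deltaEta X η x}, A j) := by
  intro x hx
  obtain ⟨j, hj⟩ := mem_iUnion.1 (hcover ▸ hXB hx)
  by_contra hcon
  simp only [mem_union, mem_iUnion, mem_ofPred_eq, exists_prop, not_or, not_exists, not_and'] at hcon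
  have hN := hcon.1 j hj
  have hF := hcon.2 j hj
  push Not at hN hF
  obtain ⟨u, ⟨huA, huX⟩, hu⟩ := hN
  obtain ⟨v, ⟨hvA, hvX⟩, hv⟩ := hF
  have hne : {ρ : ℝ | 0 < ρ ∧ ∃ z ∈ closedBall (0 : EuclideanSpace ℝ (Fin d)) 1,
      A j ⊆ closedBall z ρ}.Nonempty :=
    ⟨1, one_pos, 0, mem_closedBall_self zero_le_one, hcover ▸ subset_iUnion A j⟩
  obtain ⟨ρ, ⟨-, z, -, hAz⟩, hρr⟩ := exists_lt_of_csInf_lt hne (hrad j)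
  have huv : edist u v ≤ ENNReal.ofReal (2 * s) := by
    rw [edist_dist]
    apply ENNReal.ofReal_le_ofReal
    have h₁ := mem_closedBall.1 (hAz huA)
    have h₂ := mem_closedBall.1 (hAz hvA)
    linarith [dist_triangle_right u v z]
  have hle : deltaEta X η u ≤ deltaEta X η v + edist u v :=
    deltaEta_le_deltaEta_add_edist (hbd1.subset.trans fun _ h ↦ h.1.2) (hbd2.subset.trans fun _ h ↦ h.1.2) huX hvX
  refine hu.not_ge (hle.trans ((add_le_add hv.le huv).trans ?_))
  rw [← ENNReal.ofReal_add (by linarith) (by linarith)]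
  exact ENNReal.ofReal_le_ofReal (by linarith)
end

section
/- Let X ⊆ ℝ^d be Borel, μ a finite Borel measure on X, and η : X → [0,1] measurable. Let ζ ∈ [0,∞) and c_LC > 0 be such that Δ_η(x)^ζ ≤ c_LC·|2η(x) − 1| for μ-almost all x ∈ X. Let s > 0 and let F ⊆ X be a measurable set with Δ_η(x) ≥ s for all x ∈ F. Define f*(x) := 1 if η(x) ≥ 1/2 and f*(x) := −1 if η(x) < 1/2. Then for every measurable f : X → [−1,1], ∫_F [ η(x)·(L(1,f(x)) − L(1,f*(x)))² + (1 − η(x))·(L(−1,f(x)) − L(−1,f*(x)))² ] dμ(x) ≤ (2·c_LC / s^ζ) · ∫_F [ η(x)·(L(1,f(x)) − L(1,f*(x))) + (1 − η(x))·(L(−1,f(x)) − L(−1,f*(x))) ] dμ(x). -/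
open Set Metric MeasureTheory ENNReal

/-- The hinge loss `L(y,t) = max {0, 1 - y t}`. -/
def hinge (y t : ℝ) : ℝ := max 0 (1 - y * t)

/-- A Bayes decision function `f* = sign (2η - 1)`. -/
noncomputable def fstar (η : ℝ) : ℝ := if 1/2 ≤ η then 1 else -1

theorem hinge_one_of_mem_Icc {t : ℝ} (ht : t ∈ Icc (-1 : ℝ) 1) : hinge 1 t = 1 - t := by
  rw [hinge, one_mul, max_eq_right (by linarith [ht.2])]

theorem hinge_neg_one_of_mem_Icc {t : ℝ} (ht : t ∈ Icc (-1 : ℝ) 1) : hinge (-1) t = 1 + t := by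
  rw [hinge, neg_one_mul, sub_neg_eq_add, max_eq_right (by linarith [ht.1])]

theorem fstar_mem_Icc (u : ℝ) : fstar u ∈ Icc (-1 : ℝ) 1 := by
  unfold fstar
  split_ifs <;> norm_num

theorem hinge_variance_eq {t : ℝ} (ht : t ∈ Icc (-1 : ℝ) 1) (u : ℝ) :
    u * (hinge 1 t - hinge 1 (fstar u)) ^ 2
      + (1 - u) * (hinge (-1) t - hinge (-1) (fstar u)) ^ 2 = |t - fstar u| ^ 2 := by
  rw [hinge_one_of_mem_Icc ht, hinge_neg_one_of_mem_Icc ht,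
    hinge_one_of_mem_Icc (fstar_mem_Icc u), hinge_neg_one_of_mem_Icc (fstar_mem_Icc u), sq_abs]
  ring

theorem hinge_excess_eq {t : ℝ} (ht : t ∈ Icc (-1 : ℝ) 1) (u : ℝ) :
    u * (hinge 1 t - hinge 1 (fstar u))
      + (1 - u) * (hinge (-1) t - hinge (-1) (fstar u)) = |2 * u - 1| * |t - fstar u| := by
  rw [hinge_one_of_mem_Icc ht, hinge_neg_one_of_mem_Icc ht,
    hinge_one_of_mem_Icc (fstar_mem_Icc u), hinge_neg_one_of_mem_Icc (fstar_mem_Icc u)]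
  unfold fstar
  split_ifs with h
  · rw [abs_of_nonneg (by linarith : 0 ≤ 2 * u - 1),
      abs_of_nonpos (by linarith [ht.2] : t - 1 ≤ 0)]
    ring
  · rw [abs_of_nonpos (by linarith : 2 * u - 1 ≤ 0),
      abs_of_nonneg (by linarith [ht.1] : 0 ≤ t - -1)]
    ring

theorem abs_sub_fstar_le_two {t : ℝ} (ht : t ∈ Icc (-1 : ℝ) 1) (u : ℝ) :
    |t - fstar u| ≤ 2 := by
  have h := fstar_mem_Icc u
  rw [abs_le]
  constructor <;> linarith [ht.1, ht.2, h.1, h.2]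

theorem measurable_fstar : Measurable fstar :=
  Measurable.ite measurableSet_Ici measurable_const measurable_const

theorem statement2
    (d : ℕ) (hd : 1 ≤ d)
    (X : Set (EuclideanSpace ℝ (Fin d))) (hX : MeasurableSet X)
    (μ : Measure (EuclideanSpace ℝ (Fin d))) [IsFiniteMeasure μ] (hμX : μ Xᶜ = 0)
    (η : EuclideanSpace ℝ (Fin d) → ℝ) (hηm : Measurable η)
    (hη01 : ∀ x ∈ X, η x ∈ Icc (0 : ℝ) 1)
    (ζ : ℝ) (hζ : 0 ≤ ζ) (cLC : ℝ) (hcLC : 0 < cLC)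
    (hLC : ∀ᵐ x ∂μ, x ∈ X → deltaEta X η x ^ ζ ≤ ENNReal.ofReal (cLC * |2 * η x - 1|))
    (s : ℝ) (hs : 0 < s)
    (F : Set (EuclideanSpace ℝ (Fin d))) (hF : MeasurableSet F) (hFX : F ⊆ X)
    (hFs : ∀ x ∈ F, ENNReal.ofReal s ≤ deltaEta X η x)
    (f : EuclideanSpace ℝ (Fin d) → ℝ) (hf : Measurable f)
    (hf1 : ∀ x, f x ∈ Icc (-1 : ℝ) 1) :
    (∫ x in F, (η x * (hinge 1 (f x) - hinge 1 (fstar (η x))) ^ 2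
        + (1 - η x) * (hinge (-1) (f x) - hinge (-1) (fstar (η x))) ^ 2) ∂μ)
      ≤ (2 * cLC / s ^ ζ) *
        ∫ x in F, (η x * (hinge 1 (f x) - hinge 1 (fstar (η x)))
          + (1 - η x) * (hinge (-1) (f x) - hinge (-1) (fstar (η x)))) ∂μ := by
  simp only [hinge_variance_eq (hf1 _), hinge_excess_eq (hf1 _)]
  have hsζ : 0 < s ^ ζ := Real.rpow_pos_of_pos hs ζ
  have hint : Integrable (fun x => |2 * η x - 1| * |f x - fstar (η x)|) (μ.restrict F) := by
    have hm : Measurable fun x => |2 * η x - 1| * |f x - fstar (η x)| :=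
      ((hηm.const_mul 2).sub_const 1).abs.mul (hf.sub (measurable_fstar.comp hηm)).abs
    refine Integrable.of_bound hm.aestronglyMeasurable (1 * 2) ?_
    filter_upwards [ae_restrict_mem hF] with x hx
    have hη := hη01 x (hFX hx)
    rw [Real.norm_of_nonneg (by positivity)]
    refine mul_le_mul ?_ (abs_sub_fstar_le_two (hf1 x) _) (abs_nonneg _) zero_le_one
    rw [abs_le]
    constructor <;> linarith [hη.1, hη.2]
  rw [← integral_const_mul]
  refine integral_mono_of_nonneg (ae_of_all _ fun x => sq_nonneg _) (hint.const_mul _) ?_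
  filter_upwards [ae_restrict_mem hF, ae_restrict_of_ae hLC] with x hx hxLC
  have hmargin : s ^ ζ ≤ cLC * |2 * η x - 1| := by
    have h := (ENNReal.rpow_le_rpow (hFs x hx) hζ).trans (hxLC (hFX hx))
    rwa [ENNReal.ofReal_rpow_of_pos hs, ENNReal.ofReal_le_ofReal_iff (by positivity)] at h
  calc |f x - fstar (η x)| ^ 2
      ≤ 2 * |f x - fstar (η x)| := by
        rw [sq]
        exact mul_le_mul_of_nonneg_right (abs_sub_fstar_le_two (hf1 x) _) (abs_nonneg _)
    _ ≤ 2 * (cLC * |2 * η x - 1| / s ^ ζ) * |f x - fstar (η x)| := by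
        have h : 1 ≤ cLC * |2 * η x - 1| / s ^ ζ := (one_le_div hsζ).2 hmargin
        exact mul_le_mul_of_nonneg_right (by linarith) (abs_nonneg _)
    _ = 2 * cLC / s ^ ζ * (|2 * η x - 1| * |f x - fstar (η x)|) := by ring
end

section
/- Let d ≥ 1, r, γ > 0, z ∈ ℝ^d, and let X₁, X₋₁ be disjoint Borel subsets of ℝ^d with λ^d(B_{3r}(z) ∖ (X₁ ∪ X₋₁)) = 0. Let A ⊆ B_r(z) satisfy A ∩ X₁ ≠ ∅ and A ∩ X₋₁ ≠ ∅. Define f : ℝ^d → ℝ by f := (π·γ²)^{−d/4}·(1_{B_{3r}(z) ∩ X₁} − 1_{B_{3r}(z) ∩ X₋₁}). Then for every x ∈ A ∩ X₁, |(K_γ ∗ f)(x) − 1| ≤ (2/Γ(d/2)) · ∫_{2·Δ(x)²/γ²}^{∞} e^{−t}·t^{d/2−1} dt with Δ(x) := inf{‖x − x'‖₂ : x' ∈ X₋₁}, and for every x ∈ A ∩ X₋₁, |(K_γ ∗ f)(x) + 1| ≤ (2/Γ(d/2)) · ∫_{2·Δ(x)²/γ²}^{∞} e^{−t}·t^{d/2−1}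 dt with Δ(x) := inf{‖x − x'‖₂ : x' ∈ X₁}. -/
open Set Metric MeasureTheory

/-- The function `K_γ(u) = (2/(√π γ))^{d/2} exp(-2‖u‖²/γ²)`. -/
noncomputable def gaussK (d : ℕ) (γ : ℝ) (u : EuclideanSpace ℝ (Fin d)) : ℝ :=
  (2 / (Real.sqrt Real.pi * γ)) ^ ((d : ℝ) / 2) * Real.exp (-2 * ‖u‖ ^ 2 / γ ^ 2)

/-- The convolution `(K_γ ∗ g)(x) = ∫ K_γ(x - y) g(y) dλ^d(y)`. -/
noncomputable def convK (d : ℕ) (γ : ℝ) (g : EuclideanSpace ℝ (Fin d) → ℝ)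
    (x : EuclideanSpace ℝ (Fin d)) : ℝ :=
  ∫ y, gaussK d γ (x - y) * g y

/-- The function `f = (π γ²)^{-d/4} (1_{B_ρ(z) ∩ X₁} - 1_{B_ρ(z) ∩ X₋₁})`. -/
noncomputable def signFun (d : ℕ) (γ ρ : ℝ) (z : EuclideanSpace ℝ (Fin d))
    (X1 Xm1 : Set (EuclideanSpace ℝ (Fin d))) (y : EuclideanSpace ℝ (Fin d)) : ℝ :=
  (Real.pi * γ ^ 2) ^ (-(d : ℝ) / 4) *
    ((closedBall z ρ ∩ X1).indicator (fun _ => (1 : ℝ)) y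
      - (closedBall z ρ ∩ Xm1).indicator (fun _ => (1 : ℝ)) y)

theorem image_mul_sq_Ioi {a b : ℝ} (ha : 0 ≤ a) (hb : 0 < b) :
    (fun y : ℝ => b * y ^ 2) '' Ioi a = Ioi (b * a ^ 2) := by
  ext t
  simp only [mem_image, mem_Ioi]
  constructor
  · rintro ⟨y, hy, rfl⟩
    gcongr
  · intro ht
    have ht' : a ^ 2 < t / b := by rwa [lt_div_iff₀ hb, mul_comm]
    refine ⟨√(t / b), Real.lt_sqrt_of_sq_lt ht', ?_⟩
    rw [Real.sq_sqrt ((sq_nonneg a).trans ht'.le)]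
    field_simp

theorem integral_Ioi_pow_mul_exp_neg_mul_sq (d : ℕ) (hd : 1 ≤ d) {a b : ℝ} (ha : 0 ≤ a)
    (hb : 0 < b) :
    ∫ t in Ioi (b * a ^ 2), Real.exp (-t) * t ^ ((d : ℝ) / 2 - 1)
      = 2 * b ^ ((d : ℝ) / 2) * ∫ y in Ioi a, y ^ (d - 1) * Real.exp (-b * y ^ 2) := by
  have hinj : InjOn (fun y : ℝ => b * y ^ 2) (Ioi a) := by
    intro y hy w hw h
    have hy' : 0 ≤ y := ha.trans (le_of_lt hy)
    have hw' : 0 ≤ w := ha.trans (le_of_lt hw)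
    have h2 : y ^ 2 = w ^ 2 := mul_left_cancel₀ hb.ne' h
    exact (pow_left_inj₀ hy' hw' two_ne_zero).1 h2
  have hderiv : ∀ y ∈ Ioi a,
      HasDerivWithinAt (fun y : ℝ => b * y ^ 2) (b * (2 * y)) (Ioi a) y := by
    intro y _
    simpa using (((hasDerivAt_id y).pow 2).const_mul b).hasDerivWithinAt
  rw [← image_mul_sq_Ioi ha hb,
    integral_image_eq_integral_abs_deriv_smul measurableSet_Ioi hderiv hinj,
    ← integral_const_mul]
  refine setIntegral_congr_fun measurableSet_Ioi fun y hy => ?_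
  have hy0 : 0 < y := ha.trans_lt hy
  have hpow : (b * y ^ 2) ^ ((d : ℝ) / 2 - 1) * (b * y) = b ^ ((d : ℝ) / 2) * y ^ (d - 1) := by
    rw [Real.mul_rpow hb.le (by positivity), Real.rpow_sub_one hb.ne',
      ← Real.rpow_natCast y 2, ← Real.rpow_mul hy0.le, ← Real.rpow_natCast y (d - 1),
      Nat.cast_sub hd]
    have : ((2 : ℕ) : ℝ) * ((d : ℝ) / 2 - 1) = ((d : ℝ) - (1 : ℕ)) - 1 := by
      push_cast; ring
    rw [this, Real.rpow_sub_one hy0.ne']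
    field_simp
  simp only [smul_eq_mul]
  rw [abs_of_pos (by positivity), neg_mul]
  linear_combination (2 * Real.exp (-(b * y ^ 2))) * hpow

theorem integral_indicator_Ici_exp_neg_mul_sq_norm (d : ℕ) (hd : 1 ≤ d) {a b : ℝ} (ha : 0 ≤ a)
    (hb : 0 < b) :
    ∫ u : EuclideanSpace ℝ (Fin d),
        (Ici a).indicator (fun s : ℝ => Real.exp (-b * s ^ 2)) ‖u‖
      = d * volume.real (ball (0 : EuclideanSpace ℝ (Fin d)) 1) / (2 * b ^ ((d : ℝ) / 2))
        * ∫ t in Ioi (b * a ^ 2), Real.exp (-t) * t ^ ((d : ℝ) / 2 - 1) := by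
  have : Nonempty (Fin d) := ⟨⟨0, hd⟩⟩
  have hset : ∫ y in Ioi (0 : ℝ),
      y ^ (d - 1) • (Ici a).indicator (fun s : ℝ => Real.exp (-b * s ^ 2)) y
      = ∫ y in Ioi a, y ^ (d - 1) * Real.exp (-b * y ^ 2) := by
    have h1 : ∀ y : ℝ, y ^ (d - 1) • (Ici a).indicator (fun s : ℝ => Real.exp (-b * s ^ 2)) y
        = (Ici a).indicator (fun s : ℝ => s ^ (d - 1) * Real.exp (-b * s ^ 2)) y := by
      intro y
      by_cases hy : y ∈ Ici a <;> simp [hy]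
    simp_rw [h1]
    rw [setIntegral_indicator measurableSet_Ici]
    refine setIntegral_congr_set ?_
    have h2 : (Ioi 0 ∩ Ioi a : Set ℝ) = Ioi a := by
      rw [Ioi_inter_Ioi, sup_eq_right.2 ha]
    have h3 : (Ioi 0 ∩ Ici a : Set ℝ) =ᵐ[volume] (Ioi 0 ∩ Ioi a : Set ℝ) :=
      ae_eq_set_inter (Filter.EventuallyEq.refl _ _) Ioi_ae_eq_Ici.symm
    rwa [h2] at h3
  rw [integral_fun_norm_addHaar, finrank_euclideanSpace_fin, hset,
    integral_Ioi_pow_mul_exp_neg_mul_sq d hd ha hb, nsmul_eq_mul, smul_eq_mul]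
  have : b ^ ((d : ℝ) / 2) ≠ 0 := by positivity
  field_simp

theorem integral_exp_neg_mul_sq_norm_euclidean (d : ℕ) {b : ℝ} (hb : 0 < b) :
    ∫ u : EuclideanSpace ℝ (Fin d), Real.exp (-b * ‖u‖ ^ 2)
      = (Real.pi / b) ^ ((d : ℝ) / 2) := by
  have := GaussianFourier.integral_rexp_neg_mul_sq_norm (V := EuclideanSpace ℝ (Fin d)) hb
  rwa [finrank_euclideanSpace_fin] at this

theorem integrable_exp_neg_mul_sq_norm_euclidean (d : ℕ) {b : ℝ} (hb : 0 < b) :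
    Integrable fun u : EuclideanSpace ℝ (Fin d) => Real.exp (-b * ‖u‖ ^ 2) := by
  refine .of_integral_ne_zero ?_
  rw [integral_exp_neg_mul_sq_norm_euclidean d hb]
  have := Real.pi_pos
  positivity

/-- The tail of the centred Gaussian density on `ℝ^d` is a normalized incomplete Gamma function. -/
theorem integral_gaussian_tail (d : ℕ) (hd : 1 ≤ d) {a b : ℝ} (ha : 0 ≤ a) (hb : 0 < b) :
    (b / Real.pi) ^ ((d : ℝ) / 2) * ∫ u : EuclideanSpace ℝ (Fin d),
        (Ici a).indicator (fun s : ℝ => Real.exp (-b * s ^ 2)) ‖u‖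
      = (1 / Real.Gamma ((d : ℝ) / 2)) *
        ∫ t in Ioi (b * a ^ 2), Real.exp (-t) * t ^ ((d : ℝ) / 2 - 1) := by
  have hd0 : (0 : ℝ) < d / 2 := by
    have : (0 : ℝ) < d := by exact_mod_cast hd
    positivity
  have htotal := integral_indicator_Ici_exp_neg_mul_sq_norm d hd le_rfl hb
  have hone : ∀ u : EuclideanSpace ℝ (Fin d),
      (Ici (0 : ℝ)).indicator (fun s : ℝ => Real.exp (-b * s ^ 2)) ‖u‖
        = Real.exp (-b * ‖u‖ ^ 2) := fun u => indicator_of_mem (norm_nonneg u) _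
  simp_rw [hone] at htotal
  rw [integral_exp_neg_mul_sq_norm_euclidean d hb, zero_pow two_ne_zero, mul_zero,
    ← Real.Gamma_eq_integral hd0] at htotal
  have hG := Real.Gamma_pos_of_pos hd0
  rw [integral_indicator_Ici_exp_neg_mul_sq_norm d hd ha hb, ← mul_assoc]
  congr 1
  rw [eq_div_iff hG.ne', mul_assoc, ← htotal, ← Real.mul_rpow (by positivity) (by positivity)]
  have := Real.pi_pos
  rw [show b / Real.pi * (Real.pi / b) = 1 by field_simp, Real.one_rpow]

theorem gaussK_mul_normalization (d : ℕ) {γ : ℝ} (hγ : 0 < γ) (u : EuclideanSpace ℝ (Fin d)) :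
    gaussK d γ u * (Real.pi * γ ^ 2) ^ (-(d : ℝ) / 4)
      = (2 / γ ^ 2 / Real.pi) ^ ((d : ℝ) / 2) * Real.exp (-(2 / γ ^ 2) * ‖u‖ ^ 2) := by
  have hpi := Real.pi_pos
  have hsq : Real.pi * γ ^ 2 = (√Real.pi * γ) ^ (2 : ℝ) := by
    rw [Real.rpow_two, mul_pow, Real.sq_sqrt hpi.le]
  have hconst : (2 / (√Real.pi * γ)) ^ ((d : ℝ) / 2) * (Real.pi * γ ^ 2) ^ (-(d : ℝ) / 4)
      = (2 / γ ^ 2 / Real.pi) ^ ((d : ℝ) / 2) := by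
    rw [hsq, ← Real.rpow_mul (by positivity),
      show (2 : ℝ) * (-(d : ℝ) / 4) = -((d : ℝ) / 2) by ring,
      Real.rpow_neg (by positivity), ← Real.inv_rpow (by positivity),
      ← Real.mul_rpow (by positivity) (by positivity)]
    congr 1
    have h2 : √Real.pi ^ 2 = Real.pi := Real.sq_sqrt hpi.le
    field_simp
    rw [h2]
  rw [gaussK, mul_right_comm, hconst]
  congr 2
  ring

theorem signFun_swap (d : ℕ) (γ ρ : ℝ) (z : EuclideanSpace ℝ (Fin d))
    (X Y : Set (EuclideanSpace ℝ (Fin d))) (y : EuclideanSpace ℝ (Fin d)) :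
    signFun d γ ρ z X Y y = -signFun d γ ρ z Y X y := by
  unfold signFun
  ring

theorem convK_signFun_swap (d : ℕ) (γ ρ : ℝ) (z : EuclideanSpace ℝ (Fin d))
    (X Y : Set (EuclideanSpace ℝ (Fin d))) (x : EuclideanSpace ℝ (Fin d)) :
    convK d γ (signFun d γ ρ z X Y) x = -convK d γ (signFun d γ ρ z Y X) x := by
  unfold convK
  rw [← integral_neg]
  refine integral_congr_ae (.of_forall fun y => ?_)
  simp only [signFun_swap d γ ρ z X Y y, mul_neg]

/-- If `B_ρ(z)` contains all points closer to `x` than `Y`, the smoothed sign function differs from `1`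
at `x` by at most twice the Gaussian tail beyond the distance to `Y`. -/
theorem abs_convK_signFun_sub_one_le (d : ℕ) (hd : 1 ≤ d) {γ ρ : ℝ} (hγ : 0 < γ)
    (z : EuclideanSpace ℝ (Fin d)) {X Y : Set (EuclideanSpace ℝ (Fin d))}
    (hX : MeasurableSet X) (hY : MeasurableSet Y)
    (hfull : volume (closedBall z ρ \ (X ∪ Y)) = 0) {x : EuclideanSpace ℝ (Fin d)}
    (hball : ball x (infDist x Y) ⊆ closedBall z ρ) :
    |convK d γ (signFun d γ ρ z X Y) x - 1|
      ≤ (2 / Real.Gamma ((d : ℝ) / 2)) *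
        ∫ t in Ioi (2 * infDist x Y ^ 2 / γ ^ 2), Real.exp (-t) * t ^ ((d : ℝ) / 2 - 1) := by
  have hpi := Real.pi_pos
  set b : ℝ := 2 / γ ^ 2 with hb_def
  have hb : 0 < b := by positivity
  set c : ℝ := (b / Real.pi) ^ ((d : ℝ) / 2) with hc_def
  have hc : 0 < c := by positivity
  set σ : EuclideanSpace ℝ (Fin d) → ℝ := fun y =>
    (closedBall z ρ ∩ X).indicator (fun _ => (1 : ℝ)) y
      - (closedBall z ρ ∩ Y).indicator (fun _ => (1 : ℝ)) y with hσ
  have hσ_meas : Measurable σ :=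
    (measurable_const.indicator (measurableSet_closedBall.inter hX)).sub
      (measurable_const.indicator (measurableSet_closedBall.inter hY))
  have hσ_bound : ∀ y, |σ y| ≤ 1 := by
    intro y
    by_cases h1 : y ∈ closedBall z ρ ∩ X <;> by_cases h2 : y ∈ closedBall z ρ ∩ Y <;>
      simp only [hσ, h1, h2, indicator_of_mem, indicator_of_notMem, not_false_eq_true] <;>
      norm_num
  have hG_int : Integrable fun y => c * Real.exp (-b * ‖x - y‖ ^ 2) :=
    ((integrable_exp_neg_mul_sq_norm_euclidean d hb).comp_sub_left x).const_mul c
  have hG_one : ∫ y, c * Real.exp (-b * ‖x - y‖ ^ 2) = 1 := by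
    rw [integral_const_mul,
      integral_sub_left_eq_self (fun u : EuclideanSpace ℝ (Fin d) => Real.exp (-b * ‖u‖ ^ 2)),
      integral_exp_neg_mul_sq_norm_euclidean d hb, hc_def,
      ← Real.mul_rpow (by positivity) (by positivity),
      show b / Real.pi * (Real.pi / b) = 1 by field_simp, Real.one_rpow]
  have hconv : convK d γ (signFun d γ ρ z X Y) x
      = ∫ y, (c * Real.exp (-b * ‖x - y‖ ^ 2)) * σ y := by
    refine integral_congr_ae (.of_forall fun y => ?_)
    simp only [signFun, hσ]
    rw [← mul_assoc, gaussK_mul_normalization d hγ]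
  have hGσ_int : Integrable fun y => (c * Real.exp (-b * ‖x - y‖ ^ 2)) * σ y :=
    hG_int.mul_bdd (c := 1) hσ_meas.aestronglyMeasurable (.of_forall hσ_bound)
  set h : ℝ → ℝ := (Ici (infDist x Y)).indicator fun s : ℝ => Real.exp (-b * s ^ 2) with hh
  have hh_int : Integrable fun u : EuclideanSpace ℝ (Fin d) => h ‖u‖ := by
    have := (integrable_exp_neg_mul_sq_norm_euclidean d hb).indicator
      (measurable_norm (measurableSet_Ici (a := infDist x Y)))
    exact this
  have hae : ∀ᵐ y, ‖(c * Real.exp (-b * ‖x - y‖ ^ 2)) * σ y - c * Real.exp (-b * ‖x - y‖ ^ 2)‖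
      ≤ 2 * c * h ‖x - y‖ := by
    filter_upwards [measure_eq_zero_iff_ae_notMem.1 hfull] with y hy
    by_cases hd' : infDist x Y ≤ ‖x - y‖
    · rw [hh, indicator_of_mem (mem_Ici.2 hd'), ← mul_sub_one, norm_mul, Real.norm_eq_abs,
        abs_of_pos (by positivity), Real.norm_eq_abs]
      have hσ2 : |σ y - 1| ≤ 2 := by
        have := abs_le.1 (hσ_bound y)
        rw [abs_le]
        constructor <;> linarith
      calc c * Real.exp (-b * ‖x - y‖ ^ 2) * |σ y - 1|
          ≤ c * Real.exp (-b * ‖x - y‖ ^ 2) * 2 := by gcongr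
        _ = 2 * c * Real.exp (-b * ‖x - y‖ ^ 2) := by ring
    · have hlt : dist x y < infDist x Y := by rw [dist_eq_norm]; exact not_le.1 hd'
      have hyB : y ∈ closedBall z ρ := hball (by rwa [mem_ball, dist_comm])
      have hyY : y ∉ Y := notMem_of_dist_lt_infDist hlt
      have hyX : y ∈ X := by
        by_contra hyX
        exact hy ⟨hyB, by simp [hyX, hyY]⟩
      have hσ1 : σ y = 1 := by simp [hσ, hyB, hyX, hyY]
      rw [hh, indicator_of_notMem (by simpa using hd'), hσ1]
      simp
  have hbound := norm_integral_le_of_norm_le ((hh_int.comp_sub_left x).const_mul (2 * c)) hae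
  rw [integral_sub hGσ_int hG_int, ← hconv, hG_one, Real.norm_eq_abs, integral_const_mul,
    integral_sub_left_eq_self (fun u : EuclideanSpace ℝ (Fin d) => h ‖u‖)] at hbound
  refine hbound.trans_eq ?_
  have htail := integral_gaussian_tail d hd (infDist_nonneg (x := x) (s := Y)) hb
  rw [show 2 * infDist x Y ^ 2 / γ ^ 2 = b * infDist x Y ^ 2 by rw [hb_def]; ring]
  linear_combination 2 * htail

theorem ball_infDist_subset_closedBall {d : ℕ} {r : ℝ} {z x w : EuclideanSpace ℝ (Fin d)}
    {Y : Set (EuclideanSpace ℝ (Fin d))} (hx : x ∈ closedBall z r) (hw : w ∈ closedBall z r)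
    (hwY : w ∈ Y) : ball x (infDist x Y) ⊆ closedBall z (3 * r) := by
  intro y hy
  rw [mem_ball] at hy
  rw [mem_closedBall] at hx hw ⊢
  have h1 := infDist_le_dist_of_mem (x := x) hwY
  have h2 := dist_triangle_right x w z
  have h3 := dist_triangle y x z
  linarith

theorem statement7
    (d : ℕ) (hd : 1 ≤ d) (r γ : ℝ) (hr : 0 < r) (hγ : 0 < γ)
    (z : EuclideanSpace ℝ (Fin d))
    (X1 Xm1 : Set (EuclideanSpace ℝ (Fin d)))
    (hX1 : MeasurableSet X1) (hXm1 : MeasurableSet Xm1) (hdisj : Disjoint X1 Xm1)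
    (hfull : volume (closedBall z (3 * r) \ (X1 ∪ Xm1)) = 0)
    (A : Set (EuclideanSpace ℝ (Fin d))) (hA : A ⊆ closedBall z r)
    (hA1 : (A ∩ X1).Nonempty) (hAm1 : (A ∩ Xm1).Nonempty) :
    (∀ x ∈ A ∩ X1,
      |convK d γ (signFun d γ (3 * r) z X1 Xm1) x - 1|
        ≤ (2 / Real.Gamma ((d : ℝ) / 2)) *
          ∫ t in Set.Ioi (2 * infDist x Xm1 ^ 2 / γ ^ 2),
            Real.exp (-t) * t ^ ((d : ℝ) / 2 - 1))
    ∧ (∀ x ∈ A ∩ Xm1,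
      |convK d γ (signFun d γ (3 * r) z X1 Xm1) x + 1|
        ≤ (2 / Real.Gamma ((d : ℝ) / 2)) *
          ∫ t in Set.Ioi (2 * infDist x X1 ^ 2 / γ ^ 2),
            Real.exp (-t) * t ^ ((d : ℝ) / 2 - 1)) := by
  obtain ⟨p, hpA, hp⟩ := hA1
  obtain ⟨q, hqA, hq⟩ := hAm1
  refine ⟨fun x hx => ?_, fun x hx => ?_⟩
  · exact abs_convK_signFun_sub_one_le d hd hγ z hX1 hXm1 hfull
      (ball_infDist_subset_closedBall (hA hx.1) (hA hqA) hq)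
  · rw [convK_signFun_swap, neg_add_eq_sub, abs_sub_comm]
    exact abs_convK_signFun_sub_one_le d hd hγ z hXm1 hX1 (by rwa [union_comm])
      (ball_infDist_subset_closedBall (hA hx.1) (hA hpA) hp)
end

section
/- Let d ≥ 1, r, γ, ω₋ > 0, set ω₊ := ω₋ + r, let z ∈ ℝ^d and A ⊆ B_r(z). Let C ⊆ ℝ^d be a Borel set with λ^d(B_{ω₊}(z) ∖ C) = 0, and define g : ℝ^d → ℝ by g := (π·γ²)^{−d/4}·1_{B_{ω₊}(z) ∩ C}. Then for every x ∈ A, 0 ≤ 1 − (K_γ ∗ g)(x) ≤ (1/Γ(d/2)) · ∫_{2·ω₋²/γ²}^{∞} e^{−t}·t^{d/2−1} dt. -/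
open Set Metric MeasureTheory

/-- The function `g = (π γ²)^{-d/4} · 1_{B_ρ(z) ∩ C}`. -/
noncomputable def plateauFun (d : ℕ) (γ ρ : ℝ) (z : EuclideanSpace ℝ (Fin d))
    (C : Set (EuclideanSpace ℝ (Fin d))) (y : EuclideanSpace ℝ (Fin d)) : ℝ :=
  (Real.pi * γ ^ 2) ^ (-(d : ℝ) / 4) * (closedBall z ρ ∩ C).indicator (fun _ => (1 : ℝ)) y

/-- Polar coordinates for functions of `b * ‖x‖ ^ 2` on Euclidean space. -/
lemma integral_comp_mul_norm_sq (d : ℕ) (hd : 1 ≤ d) {b : ℝ} (hb : 0 < b) (g : ℝ → ℝ) :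
    ∫ x : EuclideanSpace ℝ (Fin d), g (b * ‖x‖ ^ 2) =
      (Real.pi / b) ^ ((d : ℝ) / 2) / Real.Gamma ((d : ℝ) / 2) *
        ∫ t in Ioi (0 : ℝ), t ^ ((d : ℝ) / 2 - 1) * g t := by
  have hd0 : (0 : ℝ) < d := by exact_mod_cast hd
  have : Nonempty (Fin d) := ⟨⟨0, hd⟩⟩
  have hG : 0 < Real.Gamma ((d : ℝ) / 2) := Real.Gamma_pos_of_pos (by positivity)
  have hvol : (volume : Measure (EuclideanSpace ℝ (Fin d))).real (ball 0 1) =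
      Real.pi ^ ((d : ℝ) / 2) / ((d : ℝ) / 2 * Real.Gamma ((d : ℝ) / 2)) := by
    rw [Measure.real, EuclideanSpace.volume_ball, Real.Gamma_add_one (by simp; positivity)]
    simp only [ENNReal.ofReal_one, one_pow, one_mul, Fintype.card_fin]
    rw [ENNReal.toReal_ofReal (by positivity), Real.sqrt_eq_rpow, ← Real.rpow_natCast,
      ← Real.rpow_mul Real.pi_pos.le]
    congr 2
    ring
  have hsubst : ∫ t in Ioi (0 : ℝ), t ^ ((d : ℝ) / 2 - 1) * g t =
      2 * b ^ ((d : ℝ) / 2) * ∫ y in Ioi (0 : ℝ), y ^ (d - 1) * g (b * y ^ 2) := by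
    have h1 := integral_comp_mul_left_Ioi (fun t => t ^ ((d : ℝ) / 2 - 1) * g t) 0 hb
    have h2 := integral_comp_rpow_Ioi_of_pos
      (g := fun t => (b * t) ^ ((d : ℝ) / 2 - 1) * g (b * t)) (p := 2) (by norm_num)
    rw [mul_zero, ← h2, smul_eq_mul, inv_mul_eq_div, eq_div_iff hb.ne'] at h1
    rw [← h1, mul_comm, ← integral_const_mul, ← integral_const_mul]
    refine setIntegral_congr_fun measurableSet_Ioi fun y (hy : 0 < y) => ?_
    have hpow : y * (y ^ 2) ^ ((d : ℝ) / 2 - 1) = y ^ (d - 1) := by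
      rw [← Real.rpow_natCast y (d - 1), ← Real.rpow_natCast y 2, ← Real.rpow_mul hy.le]
      nth_rewrite 1 [← Real.rpow_one y]
      rw [← Real.rpow_add hy, Nat.cast_sub hd]
      congr 1
      push_cast
      ring
    have hbpow : b * b ^ ((d : ℝ) / 2 - 1) = b ^ ((d : ℝ) / 2) := by
      rw [Real.rpow_sub_one hb.ne']
      field_simp
    have h21 : (2 : ℝ) - 1 = 1 := by norm_num
    simp only [smul_eq_mul, Real.rpow_two, h21, Real.rpow_one]
    rw [Real.mul_rpow hb.le (by positivity), ← hpow, ← hbpow]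
    ring
  rw [integral_fun_norm_addHaar volume (fun y => g (b * y ^ 2)), hvol, hsubst,
    Real.div_rpow Real.pi_pos.le hb.le, finrank_euclideanSpace_fin]
  simp only [nsmul_eq_mul, smul_eq_mul]
  have := Real.rpow_pos_of_pos hb ((d : ℝ) / 2)
  field_simp

/-- The normalization of the Gaussian kernel against the height of the plateau function. -/
lemma gaussK_mul_plateau_const (d : ℕ) {γ : ℝ} (hγ : 0 < γ) :
    (2 / (Real.sqrt Real.pi * γ)) ^ ((d : ℝ) / 2) * (Real.pi * γ ^ 2) ^ (-(d : ℝ) / 4) =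
      ((Real.pi / (2 / γ ^ 2)) ^ ((d : ℝ) / 2))⁻¹ := by
  have hpi := Real.pi_pos
  have hs : Real.pi * γ ^ 2 = (Real.sqrt Real.pi * γ) ^ (2 : ℝ) := by
    rw [Real.rpow_two, mul_pow, Real.sq_sqrt hpi.le]
  have he : (2 : ℝ) * (-(d : ℝ) / 4) = -((d : ℝ) / 2) := by ring
  rw [hs, ← Real.rpow_mul (by positivity), he, Real.rpow_neg (by positivity),
    ← Real.inv_rpow (by positivity), ← Real.inv_rpow (by positivity),
    ← Real.mul_rpow (by positivity) (by positivity)]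
  congr 1
  have := Real.sq_sqrt hpi.le
  field_simp
  rw [this]

theorem statement8
    (d : ℕ) (hd : 1 ≤ d) (r γ ωm : ℝ) (hr : 0 < r) (hγ : 0 < γ) (hωm : 0 < ωm)
    (z : EuclideanSpace ℝ (Fin d))
    (A : Set (EuclideanSpace ℝ (Fin d))) (hA : A ⊆ closedBall z r)
    (C : Set (EuclideanSpace ℝ (Fin d))) (hC : MeasurableSet C)
    (hfull : volume (closedBall z (ωm + r) \ C) = 0)
    (x : EuclideanSpace ℝ (Fin d)) (hx : x ∈ A) :
    0 ≤ 1 - convK d γ (plateauFun d γ (ωm + r) z C) x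
      ∧ 1 - convK d γ (plateauFun d γ (ωm + r) z C) x
        ≤ (1 / Real.Gamma ((d : ℝ) / 2)) *
          ∫ t in Set.Ioi (2 * ωm ^ 2 / γ ^ 2), Real.exp (-t) * t ^ ((d : ℝ) / 2 - 1) := by
  have hb : 0 < 2 / γ ^ 2 := by positivity
  have hd0 : (0 : ℝ) < d := by exact_mod_cast hd
  have hG : 0 < Real.Gamma ((d : ℝ) / 2) := Real.Gamma_pos_of_pos (by positivity)
  have hpi := Real.pi_pos
  set b : ℝ := 2 / γ ^ 2 with hbdef
  set c : ℝ := ((Real.pi / b) ^ ((d : ℝ) / 2))⁻¹ with hc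
  have hcpos : 0 < c := by positivity
  set φ : EuclideanSpace ℝ (Fin d) → ℝ := fun u => c * Real.exp (-(b * ‖u‖ ^ 2)) with hφ
  have hφpos : ∀ u, 0 ≤ φ u := fun u => by positivity
  have hφone : ∫ u, φ u = 1 := by
    have := GaussianFourier.integral_rexp_neg_mul_sq_norm (V := EuclideanSpace ℝ (Fin d)) hb
    simp only [hφ, integral_const_mul, ← neg_mul]
    rw [this, finrank_euclideanSpace_fin, hc]
    exact inv_mul_cancel₀ (by positivity)
  have hφint : Integrable φ := by
    by_contra h
    rw [integral_undef h] at hφone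
    norm_num at hφone
  have hψint : Integrable fun y => φ (x - y) := hφint.comp_sub_left x
  have hψone : ∫ y, φ (x - y) = 1 := by rw [integral_sub_left_eq_self φ volume x, hφone]
  have hS : MeasurableSet (closedBall z (ωm + r) ∩ C) := measurableSet_closedBall.inter hC
  have hconv : convK d γ (plateauFun d γ (ωm + r) z C) x =
      ∫ y in closedBall z (ωm + r) ∩ C, φ (x - y) := by
    rw [convK, ← integral_indicator hS]
    congr 1 with y
    by_cases hy : y ∈ closedBall z (ωm + r) ∩ C
    · simp only [gaussK, plateauFun, indicator_of_mem hy, hφ, mul_one, hc, hbdef]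
      rw [← gaussK_mul_plateau_const d hγ, mul_right_comm]
      congr 2
      ring
    · simp [plateauFun, indicator_of_notMem hy]
  have hcompl : 1 - convK d γ (plateauFun d γ (ωm + r) z C) x =
      ∫ y in (closedBall z (ωm + r) ∩ C)ᶜ, φ (x - y) := by
    rw [hconv, ← hψone, ← integral_add_compl hS hψint]
    ring
  rw [hcompl]
  refine ⟨setIntegral_nonneg hS.compl fun y _ => hφpos _, ?_⟩
  have hT : MeasurableSet {u : EuclideanSpace ℝ (Fin d) | ωm < ‖u‖} :=
    measurableSet_lt measurable_const measurable_norm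
  have hT' : MeasurableSet {y : EuclideanSpace ℝ (Fin d) | ωm < ‖x - y‖} :=
    measurableSet_lt measurable_const (by fun_prop)
  have hsub : ∀ᵐ y, y ∈ (closedBall z (ωm + r) ∩ C)ᶜ → y ∈ {y | ωm < ‖x - y‖} := by
    have hnull : ∀ᵐ y, y ∉ closedBall z (ωm + r) \ C := measure_eq_zero_iff_ae_notMem.1 hfull
    filter_upwards [hnull] with y hy hyS
    have hyB : y ∉ closedBall z (ωm + r) := fun hB => hy ⟨hB, fun hyC => hyS ⟨hB, hyC⟩⟩
    have hxz : dist x z ≤ r := hA hx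
    rw [mem_closedBall, not_le] at hyB
    change ωm < ‖x - y‖
    rw [← dist_eq_norm]
    linarith [dist_triangle y x z, dist_comm x y]
  refine (setIntegral_mono_set hψint.integrableOn (ae_of_all _ fun y => hφpos _) hsub).trans
    (le_of_eq ?_)
  have hs : 2 * ωm ^ 2 / γ ^ 2 = b * ωm ^ 2 := by rw [hbdef]; ring
  calc ∫ y in {y | ωm < ‖x - y‖}, φ (x - y)
      = ∫ y, {u : EuclideanSpace ℝ (Fin d) | ωm < ‖u‖}.indicator φ (x - y) := by
        rw [← integral_indicator hT']
        rfl
    _ = ∫ u, {u : EuclideanSpace ℝ (Fin d) | ωm < ‖u‖}.indicator φ u :=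
        integral_sub_left_eq_self _ volume x
    _ = ∫ u : EuclideanSpace ℝ (Fin d), (Ioi (b * ωm ^ 2)).indicator
          (fun t => c * Real.exp (-t)) (b * ‖u‖ ^ 2) := by
        congr 1 with u
        have hiff : b * ωm ^ 2 < b * ‖u‖ ^ 2 ↔ ωm < ‖u‖ := by
          rw [mul_lt_mul_iff_right₀ hb, sq_lt_sq₀ hωm.le (norm_nonneg u)]
        simp only [indicator_apply, mem_Ioi, hiff, mem_ofPred_eq, hφ]
    _ = _ := by
        rw [integral_comp_mul_norm_sq d hd hb, hs]
        have hrw : ∀ t : ℝ, t ^ ((d : ℝ) / 2 - 1) *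
            (Ioi (b * ωm ^ 2)).indicator (fun t => c * Real.exp (-t)) t =
            c * (Ioi (b * ωm ^ 2)).indicator
              (fun t => Real.exp (-t) * t ^ ((d : ℝ) / 2 - 1)) t := by
          intro t
          simp only [indicator_apply]
          split_ifs <;> ring
        have hss : Ioi (b * ωm ^ 2) ⊆ Ioi 0 := Ioi_subset_Ioi (by positivity)
        simp only [hrw, integral_const_mul]
        rw [setIntegral_indicator measurableSet_Ioi, inter_eq_right.2 hss, hc]
        field_simp
end

section
/- Let d ≥ 1, r > 0, X ⊆ ℝ^d Borel, η : X → [0,1] measurable, and μ a finite Borel measure on ℝ^d with μ(ℝ^d ∖ X) = 0. Let ω₋ > 0 and ω₊ := ω₋ + r. Let J be a finite index set, (A_j)_{j∈J} pairwise disjoint Borel sets, z_j ∈ ℝ^d with A_j ⊆ B_r(z_j), such that for every j ∈ J either A_j ∩ X₋₁ = ∅, in which case set σ_j := 1 and C_j := X₁ ∪ X₀, or A_j ∩ X₁ = ∅, in which case set σ_j := −1 and C_j := X₋₁; assume λ^d(B_{ω₊}(z_j) ∖ C_j) = 0 for every j ∈ J. Let γ_j > 0, γ_max := max_{j∈J}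 γ_j, g_j := (π·γ_j²)^{−d/4}·1_{B_{ω₊}(z_j) ∩ C_j}, and f*(x) := 1 if η(x) ≥ 1/2, f*(x) := −1 if η(x) < 1/2. Then for every ξ > 0, Σ_{j∈J} ∫_{A_j} |σ_j·(K_{γ_j} ∗ g_j)(x) − f*(x)|·|2η(x) − 1| dμ(x) ≤ (2^{−ξ}·Γ(d/2 + ξ)/Γ(d/2)) · (γ_max/ω₋)^{2ξ} · Σ_{j∈J} μ(A_j). -/
open Set Metric MeasureTheory ENNReal

section Gaussian

open Module

variable {V : Type*} [NormedAddCommGroup V] [InnerProductSpace ℝ V] [FiniteDimensional ℝ V]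
  [MeasurableSpace V] [BorelSpace V] [Nontrivial V]

theorem pow_finrank_sub_one_mul_rpow {n : ℕ} (hn : 1 ≤ n) (ξ b : ℝ) {y : ℝ} (hy : 0 < y) :
    y ^ (n - 1) • (y ^ (2 * ξ) * Real.exp (-b * y ^ 2))
      = y ^ ((n : ℝ) - 1 + 2 * ξ) * Real.exp (-b * y ^ (2 : ℝ)) := by
  have h : y ^ (n - 1) = y ^ ((n : ℝ) - 1) := by
    rw [← Real.rpow_natCast, Nat.cast_sub hn, Nat.cast_one]
  rw [smul_eq_mul, h, ← mul_assoc, ← Real.rpow_add hy, Real.rpow_two]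

theorem integrable_norm_rpow_mul_exp_neg_mul_sq_norm {b ξ : ℝ} (hb : 0 < b) (hξ : 0 ≤ ξ) :
    Integrable (fun v : V ↦ ‖v‖ ^ (2 * ξ) * Real.exp (-b * ‖v‖ ^ 2)) := by
  have hn : 1 ≤ finrank ℝ V := finrank_pos
  have hn' : (1 : ℝ) ≤ finrank ℝ V := by exact_mod_cast hn
  rw [integrable_fun_norm_addHaar (volume : Measure V)
    (f := fun y : ℝ ↦ y ^ (2 * ξ) * Real.exp (-b * y ^ 2))]
  exact (integrableOn_congr_fun
    (fun y hy ↦ pow_finrank_sub_one_mul_rpow hn ξ b hy) measurableSet_Ioi).mpr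
    (integrableOn_rpow_mul_exp_neg_mul_rpow (by linarith) two_pos hb)

theorem integral_norm_rpow_mul_exp_neg_mul_sq_norm {b ξ : ℝ} (hb : 0 < b) (hξ : 0 ≤ ξ) :
    ∫ v : V, ‖v‖ ^ (2 * ξ) * Real.exp (-b * ‖v‖ ^ 2)
      = finrank ℝ V * (volume : Measure V).real (ball 0 1)
        * (b ^ (-((finrank ℝ V : ℝ) / 2 + ξ)) * (1 / 2)
          * Real.Gamma ((finrank ℝ V : ℝ) / 2 + ξ)) := by
  have hn : 1 ≤ finrank ℝ V := finrank_pos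
  have hn' : (1 : ℝ) ≤ finrank ℝ V := by exact_mod_cast hn
  rw [integral_fun_norm_addHaar (volume : Measure V)
    (fun y : ℝ ↦ y ^ (2 * ξ) * Real.exp (-b * y ^ 2)),
    setIntegral_congr_fun measurableSet_Ioi
      (fun y hy ↦ pow_finrank_sub_one_mul_rpow hn ξ b hy),
    integral_rpow_mul_exp_neg_mul_rpow two_pos (by linarith) hb, nsmul_eq_mul, smul_eq_mul,
    ← mul_assoc (finrank ℝ V : ℝ)]
  ring_nf

/-- The moment of order `2 * ξ` of a centred isotropic Gaussian, relative to its mass. -/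
theorem integral_norm_rpow_mul_exp_eq_mul_integral_exp {b ξ : ℝ} (hb : 0 < b) (hξ : 0 ≤ ξ) :
    ∫ v : V, ‖v‖ ^ (2 * ξ) * Real.exp (-b * ‖v‖ ^ 2)
      = b ^ (-ξ) * (Real.Gamma ((finrank ℝ V : ℝ) / 2 + ξ) / Real.Gamma ((finrank ℝ V : ℝ) / 2))
        * ∫ v : V, Real.exp (-b * ‖v‖ ^ 2) := by
  have hn : (0 : ℝ) < finrank ℝ V := by exact_mod_cast finrank_pos
  have h0 := integral_norm_rpow_mul_exp_neg_mul_sq_norm (V := V) hb le_rfl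
  simp only [mul_zero, Real.rpow_zero, one_mul, add_zero] at h0
  rw [h0, integral_norm_rpow_mul_exp_neg_mul_sq_norm hb hξ, neg_add, Real.rpow_add hb]
  have hΓ : Real.Gamma ((finrank ℝ V : ℝ) / 2) ≠ 0 := (Real.Gamma_pos_of_pos (by positivity)).ne'
  field_simp

theorem integrable_exp_neg_mul_sq_norm {b : ℝ} (hb : 0 < b) :
    Integrable (fun v : V ↦ Real.exp (-b * ‖v‖ ^ 2)) := by
  simpa using integrable_norm_rpow_mul_exp_neg_mul_sq_norm (V := V) hb le_rfl

/-- Markov's inequality for the Gaussian mass of the complement of a ball around the mean. -/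
theorem setIntegral_compl_ball_exp_neg_mul_sq_norm_le {b ξ ω : ℝ} (hb : 0 < b) (hξ : 0 ≤ ξ)
    (hω : 0 < ω) :
    ∫ v in (ball (0 : V) ω)ᶜ, Real.exp (-b * ‖v‖ ^ 2)
      ≤ ω ^ (-(2 * ξ)) * (b ^ (-ξ)
          * (Real.Gamma ((finrank ℝ V : ℝ) / 2 + ξ) / Real.Gamma ((finrank ℝ V : ℝ) / 2)))
        * ∫ v : V, Real.exp (-b * ‖v‖ ^ 2) := by
  have hint := (integrable_norm_rpow_mul_exp_neg_mul_sq_norm (V := V) hb hξ).const_mul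
    (ω ^ (-(2 * ξ)))
  rw [mul_assoc, ← integral_norm_rpow_mul_exp_eq_mul_integral_exp hb hξ, ← integral_const_mul]
  refine (setIntegral_mono_on (integrable_exp_neg_mul_sq_norm hb).integrableOn hint.integrableOn
    measurableSet_ball.compl fun v hv ↦ ?_).trans
    (setIntegral_le_integral hint (Filter.Eventually.of_forall fun v ↦ by positivity))
  have hv : ω ≤ ‖v‖ := by simpa using hv
  rw [← mul_assoc]
  refine le_mul_of_one_le_left (Real.exp_nonneg _) ?_
  rw [Real.rpow_neg hω.le, inv_mul_eq_div, one_le_div (by positivity)]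
  exact Real.rpow_le_rpow hω.le hv (by positivity)

end Gaussian

theorem convK_plateauFun_eq {d : ℕ} {γ : ℝ} (hγ : 0 < γ) (ρ : ℝ)
    (z : EuclideanSpace ℝ (Fin d)) {C : Set (EuclideanSpace ℝ (Fin d))} (hC : MeasurableSet C)
    (hfull : volume (closedBall z ρ \ C) = 0) (x : EuclideanSpace ℝ (Fin d)) :
    convK d γ (plateauFun d γ ρ z C) x
      = (∫ v : EuclideanSpace ℝ (Fin d), Real.exp (-(2 / γ ^ 2) * ‖v‖ ^ 2))⁻¹
        * ∫ y in closedBall z ρ, Real.exp (-(2 / γ ^ 2) * ‖x - y‖ ^ 2) := by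
  have hπ := Real.pi_pos
  have hc : (2 / (Real.sqrt Real.pi * γ)) ^ ((d : ℝ) / 2) * (Real.pi * γ ^ 2) ^ (-(d : ℝ) / 4)
      = (∫ v : EuclideanSpace ℝ (Fin d), Real.exp (-(2 / γ ^ 2) * ‖v‖ ^ 2))⁻¹ := by
    rw [GaussianFourier.integral_rexp_neg_mul_sq_norm (by positivity), finrank_euclideanSpace_fin,
      ← Real.inv_rpow (by positivity)]
    have h : Real.pi * γ ^ 2 = (Real.sqrt Real.pi * γ) ^ (2 : ℝ) := by
      rw [Real.rpow_two, mul_pow, Real.sq_sqrt hπ.le]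
    rw [h, ← Real.rpow_mul (by positivity),
      show (2 : ℝ) * (-(d : ℝ) / 4) = -((d : ℝ) / 2) by ring,
      Real.rpow_neg (by positivity), ← Real.inv_rpow (by positivity),
      ← Real.mul_rpow (by positivity) (by positivity)]
    congr 1
    field_simp
    rw [Real.sq_sqrt hπ.le]
  have hae : (closedBall z ρ ∩ C : Set (EuclideanSpace ℝ (Fin d))) =ᵐ[volume] closedBall z ρ := by
    refine Filter.EventuallyLE.antisymm inter_subset_left.eventuallyLE ?_
    rw [ae_le_set, sdiff_self_inter]
    exact hfull
  rw [← hc, ← setIntegral_congr_set hae, ← integral_indicator (measurableSet_closedBall.inter hC),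
    ← integral_const_mul]
  unfold convK gaussK plateauFun
  congr 1 with y
  by_cases hy : y ∈ closedBall z ρ ∩ C
  · rw [indicator_of_mem hy, indicator_of_mem hy]
    ring_nf
  · rw [indicator_of_notMem hy, indicator_of_notMem hy]
    simp

theorem abs_convK_plateauFun_sub_one_le {d : ℕ} (hd : 1 ≤ d) {γ r ω ξ : ℝ} (hγ : 0 < γ)
    (hω : 0 < ω) (hξ : 0 ≤ ξ) {z x : EuclideanSpace ℝ (Fin d)} (hx : x ∈ closedBall z r)
    {C : Set (EuclideanSpace ℝ (Fin d))} (hC : MeasurableSet C)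
    (hfull : volume (closedBall z (ω + r) \ C) = 0) :
    |convK d γ (plateauFun d γ (ω + r) z C) x - 1|
      ≤ (2 : ℝ) ^ (-ξ) * Real.Gamma ((d : ℝ) / 2 + ξ) / Real.Gamma ((d : ℝ) / 2)
          * (γ / ω) ^ (2 * ξ) := by
  have : Nonempty (Fin d) := ⟨⟨0, hd⟩⟩
  have hb : 0 < 2 / γ ^ 2 := by positivity
  set b := 2 / γ ^ 2 with hbdef
  set N := ∫ v : EuclideanSpace ℝ (Fin d), Real.exp (-b * ‖v‖ ^ 2) with hNdef
  have hN : 0 < N := by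
    rw [hNdef, GaussianFourier.integral_rexp_neg_mul_sq_norm hb]
    have := Real.pi_pos
    positivity
  have hint : Integrable (fun y : EuclideanSpace ℝ (Fin d) ↦ Real.exp (-b * ‖x - y‖ ^ 2)) :=
    (integrable_exp_neg_mul_sq_norm hb).comp_sub_left x
  have hsplit := integral_add_compl (measurableSet_closedBall (x := z) (ε := ω + r)) hint
  rw [integral_sub_left_eq_self (fun v ↦ Real.exp (-b * ‖v‖ ^ 2)) volume x, ← hNdef] at hsplit
  have hsub : (closedBall z (ω + r))ᶜ ⊆ (ball x ω)ᶜ := by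
    refine compl_subset_compl.mpr fun y hy ↦ ?_
    rw [mem_ball] at hy
    rw [mem_closedBall] at hx ⊢
    linarith [dist_triangle y x z]
  have htail : ∫ y in (closedBall z (ω + r))ᶜ, Real.exp (-b * ‖x - y‖ ^ 2)
      ≤ ∫ v in (ball (0 : EuclideanSpace ℝ (Fin d)) ω)ᶜ, Real.exp (-b * ‖v‖ ^ 2) := by
    refine (setIntegral_mono_set hint.integrableOn
      (Filter.Eventually.of_forall fun _ ↦ (Real.exp_nonneg _)) hsub.eventuallyLE).trans_eq ?_
    rw [← integral_indicator measurableSet_ball.compl,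
      ← integral_indicator measurableSet_ball.compl,
      ← integral_sub_left_eq_self _ volume x]
    congr 1 with y
    simp [indicator]
  have hmarkov := htail.trans (setIntegral_compl_ball_exp_neg_mul_sq_norm_le hb hξ hω)
  rw [finrank_euclideanSpace_fin, ← hNdef] at hmarkov
  have hnonneg : 0 ≤ ∫ y in (closedBall z (ω + r))ᶜ, Real.exp (-b * ‖x - y‖ ^ 2) :=
    integral_nonneg fun _ ↦ Real.exp_nonneg _
  have hconst : ω ^ (-(2 * ξ)) * (b ^ (-ξ)
        * (Real.Gamma ((d : ℝ) / 2 + ξ) / Real.Gamma ((d : ℝ) / 2)))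
      = (2 : ℝ) ^ (-ξ) * Real.Gamma ((d : ℝ) / 2 + ξ) / Real.Gamma ((d : ℝ) / 2)
          * (γ / ω) ^ (2 * ξ) := by
    have hbξ : b ^ (-ξ) = (2 : ℝ) ^ (-ξ) * γ ^ (2 * ξ) := by
      rw [hbdef, Real.div_rpow two_pos.le (by positivity), ← Real.rpow_two, ← Real.rpow_mul hγ.le,
        mul_neg, Real.rpow_neg hγ.le, div_inv_eq_mul]
    rw [hbξ, Real.div_rpow hγ.le hω.le, Real.rpow_neg hω.le]
    ring
  rw [hconst] at hmarkov
  rw [convK_plateauFun_eq hγ _ z hC hfull x, ← hbdef, ← hNdef]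
  set T := ∫ y in (closedBall z (ω + r))ᶜ, Real.exp (-b * ‖x - y‖ ^ 2)
  rw [eq_sub_of_add_eq hsplit, mul_sub, inv_mul_cancel₀ hN.ne', sub_sub_cancel_left, abs_neg,
    abs_of_nonneg (by positivity), inv_mul_le_iff₀ hN, mul_comm N]
  exact hmarkov

theorem statement10
    (d : ℕ) (hd : 1 ≤ d) (r ωm : ℝ) (hr : 0 < r) (hωm : 0 < ωm)
    (X : Set (EuclideanSpace ℝ (Fin d))) (hX : MeasurableSet X)
    (η : EuclideanSpace ℝ (Fin d) → ℝ) (hηm : Measurable η)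
    (hη01 : ∀ x ∈ X, η x ∈ Icc (0 : ℝ) 1)
    (μ : Measure (EuclideanSpace ℝ (Fin d))) [IsFiniteMeasure μ] (hμX : μ Xᶜ = 0)
    (ι : Type) (J : Finset ι) (hJne : J.Nonempty)
    (A : ι → Set (EuclideanSpace ℝ (Fin d))) (hAmeas : ∀ j ∈ J, MeasurableSet (A j))
    (hdisj : (J : Set ι).PairwiseDisjoint A)
    (z : ι → EuclideanSpace ℝ (Fin d)) (hAz : ∀ j ∈ J, A j ⊆ closedBall (z j) r)
    (σ : ι → ℝ) (C : ι → Set (EuclideanSpace ℝ (Fin d)))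
    (hclass : ∀ j ∈ J,
      (A j ∩ {x ∈ X | η x < 1/2} = ∅ ∧ σ j = 1
          ∧ C j = {x ∈ X | 1/2 < η x} ∪ {x ∈ X | η x = 1/2})
      ∨ (A j ∩ {x ∈ X | 1/2 < η x} = ∅ ∧ σ j = -1 ∧ C j = {x ∈ X | η x < 1/2}))
    (hfull : ∀ j ∈ J, volume (closedBall (z j) (ωm + r) \ C j) = 0)
    (γ : ι → ℝ) (hγ : ∀ j ∈ J, 0 < γ j)
    (ξ : ℝ) (hξ : 0 < ξ) :
    ∑ j ∈ J, ∫ x in A j,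
        |σ j * convK d (γ j) (plateauFun d (γ j) (ωm + r) (z j) (C j)) x
          - (if 1/2 ≤ η x then (1 : ℝ) else -1)| * |2 * η x - 1| ∂μ
      ≤ (2 : ℝ) ^ (-ξ) * Real.Gamma ((d : ℝ) / 2 + ξ) / Real.Gamma ((d : ℝ) / 2)
          * (J.sup' hJne γ / ωm) ^ (2 * ξ)
          * ∑ j ∈ J, (μ (A j)).toReal := by
  have hX1 : MeasurableSet {x ∈ X | 1/2 < η x} :=
    hX.inter (measurableSet_lt measurable_const hηm)
  have hX0 : MeasurableSet {x ∈ X | η x = 1/2} :=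
    hX.inter (measurableSet_eq_fun hηm measurable_const)
  have hX2 : MeasurableSet {x ∈ X | η x < 1/2} :=
    hX.inter (measurableSet_lt hηm measurable_const)
  rw [Finset.mul_sum]
  refine Finset.sum_le_sum fun j hj ↦ ?_
  have hCmeas : MeasurableSet (C j) := by
    rcases hclass j hj with ⟨-, -, h⟩ | ⟨-, -, h⟩ <;> rw [h]
    exacts [hX1.union hX0, hX2]
  refine (Real.le_norm_self _).trans
    (norm_setIntegral_le_of_norm_le_const_ae' (measure_lt_top μ _) ?_)
  have hμX' : ∀ᵐ x ∂μ, x ∈ X := hμX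
  filter_upwards [hμX'] with x hxX hxA
  have hd0 : (0 : ℝ) < d := by exact_mod_cast hd
  have hsup : γ j ≤ J.sup' hJne γ := Finset.le_sup' γ hj
  have hΓ₁ := Real.Gamma_pos_of_pos (show 0 < (d : ℝ) / 2 + ξ by positivity)
  have hΓ₂ := Real.Gamma_pos_of_pos (show 0 < (d : ℝ) / 2 by positivity)
  have hbound := (abs_convK_plateauFun_sub_one_le hd (hγ j hj) hωm hξ.le (hAz j hj hxA) hCmeas
    (hfull j hj)).trans (mul_le_mul_of_nonneg_left
      (Real.rpow_le_rpow (div_nonneg (hγ j hj).le hωm.le)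
        (div_le_div_of_nonneg_right hsup hωm.le) (by positivity : 0 ≤ 2 * ξ)) (by positivity))
  set c := convK d (γ j) (plateauFun d (γ j) (ωm + r) (z j) (C j)) x
  have hη1 : |2 * η x - 1| ≤ 1 := by
    have := hη01 x hxX
    rw [abs_le]
    constructor <;> linarith [this.1, this.2]
  suffices h : |σ j * c - (if 1/2 ≤ η x then (1 : ℝ) else -1)| * |2 * η x - 1|
      ≤ |c - 1| * |2 * η x - 1| by
    rw [Real.norm_of_nonneg (by positivity)]
    exact h.trans ((mul_le_of_le_one_right (abs_nonneg _) hη1).trans hbound)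
  rcases hclass j hj with ⟨hA, hσ, -⟩ | ⟨hA, hσ, -⟩
  · have hη : 1/2 ≤ η x := by
      by_contra! h
      exact (hA ▸ ⟨hxA, hxX, h⟩ : x ∈ (∅ : Set _))
    rw [hσ, if_pos hη, one_mul]
  · have hη : η x ≤ 1/2 := by
      by_contra! h
      exact (hA ▸ ⟨hxA, hxX, h⟩ : x ∈ (∅ : Set _))
    rcases hη.eq_or_lt with h | h
    · simp [h]
    · rw [hσ, if_neg h.not_ge, show -1 * c - -1 = -(c - 1) by ring, abs_neg]
end

section
/- Let (X, dist) be a metric space and η : X → [0,1] a continuous function such that X₁, X₋₁ and X₀ are all nonempty and X₀ = ∂_X X₁ = ∂_X X₋₁ (boundaries relative to X). Suppose there exist δ ∈ (0,1] and c > 0 such that |η(x) − η(x')| ≥ c·dist(x,x')^δ for all x, x' ∈ X. Then for all x ∈ X, Δ_η(x)^δ ≤ (2c)^{−1}·|2η(x) − 1|; i.e., the distance to the decision boundary controls the noise from below with exponent δ and constant c_LC := (2c)^{−1}. -/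
open Set Metric

open Classical in
/-- The (real-valued) distance to the decision boundary `Δ_η` for a posterior
probability `η` on a metric space: for `x ∈ X₁` the distance to `X₋₁`, for
`x ∈ X₋₁` the distance to `X₁`, and `0` on `X₀`. -/
noncomputable def deltaEtaR {X : Type*} [MetricSpace X] (η : X → ℝ) (x : X) : ℝ :=
  if 1/2 < η x then infDist x {y | η y < 1/2}
  else if η x < 1/2 then infDist x {y | 1/2 < η y}
  else 0

/-- The distance to the decision boundary is at most the distance to any point that lies in the
closure of both classes. -/
theorem deltaEtaR_le_dist {X : Type*} [MetricSpace X] {η : X → ℝ} {z : X}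
    (hpos : z ∈ closure {x | 1/2 < η x}) (hneg : z ∈ closure {x | η x < 1/2}) (x : X) :
    deltaEtaR η x ≤ dist x z := by
  unfold deltaEtaR
  split_ifs
  · rw [← infDist_closure]
    exact infDist_le_dist_of_mem hneg
  · rw [← infDist_closure]
    exact infDist_le_dist_of_mem hpos
  · exact dist_nonneg

theorem deltaEtaR_nonneg {X : Type*} [MetricSpace X] (η : X → ℝ) (x : X) :
    0 ≤ deltaEtaR η x := by
  unfold deltaEtaR
  split_ifs <;> first | exact infDist_nonneg | exact le_rfl

theorem statement13
    (X : Type*) [MetricSpace X]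
    (η : X → ℝ) (hη01 : ∀ x, η x ∈ Icc (0 : ℝ) 1) (hcont : Continuous η)
    (h1 : {x : X | 1/2 < η x}.Nonempty)
    (hm1 : {x : X | η x < 1/2}.Nonempty)
    (h0 : {x : X | η x = 1/2}.Nonempty)
    (hbd1 : {x : X | η x = 1/2} = frontier {x : X | 1/2 < η x})
    (hbd2 : {x : X | η x = 1/2} = frontier {x : X | η x < 1/2})
    (δ c : ℝ) (hδ : δ ∈ Ioc (0 : ℝ) 1) (hc : 0 < c)
    (hrev : ∀ x x' : X, c * dist x x' ^ δ ≤ |η x - η x'|) :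
    ∀ x : X, deltaEtaR η x ^ δ ≤ (2 * c)⁻¹ * |2 * η x - 1| := by
  intro x
  obtain ⟨z, hz⟩ := h0
  have hle : deltaEtaR η x ≤ dist x z :=
    deltaEtaR_le_dist (frontier_subset_closure (hbd1 ▸ hz)) (frontier_subset_closure (hbd2 ▸ hz)) x
  have hz' : η z = 1/2 := hz
  have habs : |2 * η x - 1| = 2 * |η x - η z| := by
    rw [hz', ← abs_of_pos (two_pos : (0 : ℝ) < 2), ← abs_mul, abs_of_pos (two_pos : (0 : ℝ) < 2)]
    ring_nf
  calc deltaEtaR η x ^ δ ≤ dist x z ^ δ :=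
        Real.rpow_le_rpow (deltaEtaR_nonneg η x) hle hδ.1.le
    _ ≤ |η x - η z| / c := (le_div_iff₀' hc).2 (hrev x z)
    _ = (2 * c)⁻¹ * |2 * η x - 1| := by
        rw [habs]
        field_simp
end

section
/- Let d ≥ 1 be an integer, q ∈ [0,∞), c_d > 0, p ∈ (0,1/2), ε̃ > 0, and ε₂ ≥ max{ε̃, 2p}. Then there exists a constant C > 0, depending only on d, q, p, ε₂, c_d, such that for every integer n ≥ 1 and every r ∈ (0,1] with r^{d−1}·n ≥ 1, for every finite index set J with |J| ≤ c_d·r^{−d+1}, every family of nonnegative weights (w_j)_{j∈J} with Σ_{j∈J} w_j ≤ 1, and every admissible pair of nets (Λ, Γ) for (n, r): inf over all (λ_j)_{j∈J} ∈ Λ^J and (γ_j)_{j∈J} ∈ Γ^J of [ (r/min_{j∈J} γ_j)^d·(Σ_{j∈J} λ_j)·n^{ε̃} + (r/n)^{(q+1)/(q+2−p)}·(Σ_{j∈J} λ_j^{−1}·γ_j^{−d/p}·w_j)^{p(q+1)/(q+2−p)} ] ≤ C · n^{ε₂} · (r^{d−1}·n)^{−(q+1)/(q+2)}. -/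
open Set Finset

/-- An admissible pair of nets `(Λ, Γ)` for `(n, r)`: finite sets `Λ ⊆ (0, 1/n]` and
`Γ ⊆ (0, r]` such that every `λ ∈ (0, 1/n]` has `λ' ∈ Λ` with `λ ≤ λ' ≤ λ + 2 n⁻²`,
and every `γ ∈ (0, r]` has `γ' ∈ Γ` with `γ ≤ γ' ≤ γ + 2 r n⁻¹`. -/
def AdmissibleNets (n : ℕ) (r : ℝ) (Λ Γ : Set ℝ) : Prop :=
  Λ.Finite ∧ Λ ⊆ Set.Ioc 0 (1 / (n : ℝ)) ∧
    (∀ lam ∈ Set.Ioc (0 : ℝ) (1 / (n : ℝ)),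
      ∃ lam' ∈ Λ, lam ≤ lam' ∧ lam' ≤ lam + 2 / (n : ℝ) ^ 2) ∧
  Γ.Finite ∧ Γ ⊆ Set.Ioc 0 r ∧
    (∀ gam ∈ Set.Ioc (0 : ℝ) r,
      ∃ gam' ∈ Γ, gam ≤ gam' ∧ gam' ≤ gam + 2 * r / (n : ℝ))

theorem card_mul_le_of_le_div_sq {d : ℕ} (hd : 1 ≤ d) {q cd x r m l : ℝ} (hq : 0 ≤ q)
    (hcd : 0 < cd) (hx : 1 ≤ x) (hr : 0 < r) (hs : 1 ≤ r ^ (d - 1) * x)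
    (hm : m ≤ cd * r ^ ((1 : ℝ) - d)) (hl0 : 0 ≤ l) (hl : l ≤ 3 / x ^ 2) :
    m * l ≤ 3 * cd * (r ^ (d - 1) * x) ^ (-(q + 1) / (q + 2)) := by
  have hx0 : 0 < x := by linarith
  have hR : r ^ ((1 : ℝ) - d) = (r ^ (d - 1))⁻¹ := by
    rw [← Real.rpow_natCast, ← Real.rpow_neg hr.le, Nat.cast_sub hd]
    congr 1
    push_cast
    ring
  have hexp : (r ^ (d - 1) * x)⁻¹ ≤ (r ^ (d - 1) * x) ^ (-(q + 1) / (q + 2)) := by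
    rw [← Real.rpow_neg_one]
    apply Real.rpow_le_rpow_of_exponent_le hs
    rw [le_div_iff₀ (by linarith)]
    linarith
  have hR0 : 0 < r ^ (d - 1) := by positivity
  calc m * l ≤ cd * r ^ ((1 : ℝ) - d) * (3 / x ^ 2) := by gcongr
    _ = 3 * cd * (r ^ (d - 1) * x)⁻¹ * x⁻¹ := by
        rw [hR]
        field_simp
    _ ≤ 3 * cd * (r ^ (d - 1) * x)⁻¹ * 1 := by
        gcongr
        exact inv_le_one_of_one_le₀ hx
    _ ≤ _ := by
        rw [mul_one]
        gcongr

theorem variance_term_le {d : ℕ} (hd : 1 ≤ d) {q p ε x r l : ℝ} (hq : 0 ≤ q)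
    (hp0 : 0 < p) (hp1 : p < 1) (hε : 2 * p ≤ ε) (hx : 1 ≤ x) (hr : 0 < r)
    (hs : 1 ≤ r ^ (d - 1) * x) {ι : Type*} {J : Finset ι} {w : ι → ℝ}
    (hw : ∀ j ∈ J, 0 ≤ w j) (hw1 : ∑ j ∈ J, w j ≤ 1) (hl : 1 / x ^ 2 ≤ l) :
    (r / x) ^ ((q + 1) / (q + 2 - p))
        * (∑ j ∈ J, l⁻¹ * r ^ (-(d : ℝ) / p) * w j) ^ (p * (q + 1) / (q + 2 - p))
      ≤ x ^ ε * (r ^ (d - 1) * x) ^ (-(q + 1) / (q + 2)) := by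
  have hx0 : 0 < x := by linarith
  have hqp : 0 < q + 2 - p := by linarith
  obtain ⟨β, hβ⟩ : ∃ β, β = (q + 1) / (q + 2 - p) := ⟨_, rfl⟩
  have hβ0 : 0 ≤ β := by rw [hβ]; positivity
  have hβ1 : β ≤ 1 := by
    rw [hβ, div_le_one hqp]
    linarith
  have hβa : -β ≤ -(q + 1) / (q + 2) := by
    rw [hβ, neg_div, neg_le_neg_iff]
    gcongr
    linarith
  have hpβ : p * (q + 1) / (q + 2 - p) = p * β := by rw [hβ, mul_div_assoc]
  have hl0 : 0 < l := lt_of_lt_of_le (by positivity) hl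
  have hlinv : l⁻¹ ≤ x ^ (2 : ℝ) := by
    rw [Real.rpow_two]
    apply inv_le_of_inv_le₀ (by positivity)
    rwa [← one_div]
  have hsum0 : 0 ≤ ∑ j ∈ J, w j := Finset.sum_nonneg hw
  have hsum : ∑ j ∈ J, l⁻¹ * r ^ (-(d : ℝ) / p) * w j ≤ x ^ (2 : ℝ) * r ^ (-(d : ℝ) / p) := by
    rw [← Finset.mul_sum]
    calc l⁻¹ * r ^ (-(d : ℝ) / p) * ∑ j ∈ J, w j
        ≤ x ^ (2 : ℝ) * r ^ (-(d : ℝ) / p) * 1 := by gcongr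
      _ = _ := mul_one _
  have hsum_nonneg : 0 ≤ ∑ j ∈ J, l⁻¹ * r ^ (-(d : ℝ) / p) * w j :=
    Finset.sum_nonneg fun j hj => mul_nonneg (by positivity) (hw j hj)
  rw [hpβ, ← hβ]
  calc (r / x) ^ β * (∑ j ∈ J, l⁻¹ * r ^ (-(d : ℝ) / p) * w j) ^ (p * β)
      ≤ (r / x) ^ β * (x ^ (2 : ℝ) * r ^ (-(d : ℝ) / p)) ^ (p * β) := by gcongr
    _ = x ^ (2 * p * β) * (r ^ (d - 1) * x) ^ (-β) := by
        rw [Real.mul_rpow (by positivity) (by positivity), ← Real.rpow_mul hx0.le,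
          ← Real.rpow_mul hr.le, Real.div_rpow hr.le hx0.le,
          Real.mul_rpow (by positivity) hx0.le, ← Real.rpow_natCast, ← Real.rpow_mul hr.le,
          Nat.cast_sub hd, Nat.cast_one, Real.rpow_neg hx0.le, div_eq_mul_inv]
        have h : r ^ β * r ^ (-(d : ℝ) / p * (p * β)) = r ^ (((d : ℝ) - 1) * -β) := by
          rw [← Real.rpow_add hr]
          congr 1
          field_simp
          ring
        rw [← h, mul_assoc 2 p β]
        ring
    _ ≤ x ^ ε * (r ^ (d - 1) * x) ^ (-(q + 1) / (q + 2)) := by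
        gcongr
        nlinarith

theorem statement16
    (d : ℕ) (hd : 1 ≤ d) (q : ℝ) (hq : 0 ≤ q) (cd : ℝ) (hcd : 0 < cd)
    (p : ℝ) (hp : p ∈ Set.Ioo (0 : ℝ) (1/2)) (ε₂ : ℝ) (h2p : 2 * p ≤ ε₂) :
    ∃ C : ℝ, 0 < C ∧ ∀ εt : ℝ, 0 < εt → εt ≤ ε₂ →
      ∀ n : ℕ, 1 ≤ n → ∀ r : ℝ, r ∈ Set.Ioc (0 : ℝ) 1 → 1 ≤ r ^ (d - 1) * (n : ℝ) →
      ∀ (ι : Type) (J : Finset ι) (hJne : J.Nonempty),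
        (J.card : ℝ) ≤ cd * r ^ ((1 : ℝ) - d) →
      ∀ w : ι → ℝ, (∀ j ∈ J, 0 ≤ w j) → (∑ j ∈ J, w j) ≤ 1 →
      ∀ Λ Γ : Set ℝ, AdmissibleNets n r Λ Γ →
      ∃ lam gam : ι → ℝ, (∀ j ∈ J, lam j ∈ Λ) ∧ (∀ j ∈ J, gam j ∈ Γ) ∧
        (r / J.inf' hJne gam) ^ d * (∑ j ∈ J, lam j) * (n : ℝ) ^ εt
          + (r / (n : ℝ)) ^ ((q + 1) / (q + 2 - p))
            * (∑ j ∈ J, (lam j)⁻¹ * gam j ^ (-(d : ℝ) / p) * w j)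
              ^ (p * (q + 1) / (q + 2 - p))
        ≤ C * (n : ℝ) ^ ε₂ * (r ^ (d - 1) * (n : ℝ)) ^ (-(q + 1) / (q + 2)) := by
  obtain ⟨hp0, hp2⟩ := hp
  refine ⟨3 * cd + 1, by positivity, ?_⟩
  intro εt _ hεt2 n hn r hr hs ι J hJne hJ w hw hw1 Λ Γ hnets
  obtain ⟨hr0, -⟩ := hr
  obtain ⟨-, -, hΛ, -, hΓr, hΓ⟩ := hnets
  have hn1 : (1 : ℝ) ≤ n := by exact_mod_cast hn
  have hn0 : (0 : ℝ) < n := by linarith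
  have hrΓ : r ∈ Γ := by
    obtain ⟨g, hg, hrg, -⟩ := hΓ r ⟨hr0, le_rfl⟩
    have hgr : g ≤ r := (hΓr hg).2
    rwa [le_antisymm hrg hgr]
  obtain ⟨l, hlΛ, hl1, hl2⟩ := hΛ (1 / (n : ℝ) ^ 2) ⟨by positivity, by
    apply one_div_le_one_div_of_le hn0
    nlinarith⟩
  have hl3 : l ≤ 3 / (n : ℝ) ^ 2 := by
    have : 1 / (n : ℝ) ^ 2 + 2 / (n : ℝ) ^ 2 = 3 / (n : ℝ) ^ 2 := by ring
    linarith
  have hl0 : 0 < l := lt_of_lt_of_le (by positivity) hl1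
  refine ⟨fun _ => l, fun _ => r, fun _ _ => hlΛ, fun _ _ => hrΓ, ?_⟩
  have hfirst : (r / J.inf' hJne (fun _ => r)) ^ d * (∑ j ∈ J, l) * (n : ℝ) ^ εt
      ≤ 3 * cd * ((n : ℝ) ^ ε₂ * (r ^ (d - 1) * (n : ℝ)) ^ (-(q + 1) / (q + 2))) := by
    rw [Finset.inf'_const, div_self hr0.ne', one_pow, one_mul, Finset.sum_const, nsmul_eq_mul]
    have h := card_mul_le_of_le_div_sq hd hq hcd hn1 hr0 hs hJ hl0.le hl3
    calc (J.card : ℝ) * l * (n : ℝ) ^ εt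
        ≤ 3 * cd * (r ^ (d - 1) * (n : ℝ)) ^ (-(q + 1) / (q + 2)) * (n : ℝ) ^ ε₂ := by
          gcongr
      _ = _ := by ring
  have hsecond := variance_term_le hd hq hp0 (by linarith) h2p hn1 hr0 hs hw hw1 hl1
  linarith
end

section
/- Let d ≥ 1 be an integer, c_d > 0, p ∈ (0,1/2), ε̃ > 0, and ε₃ ≥ max{ε̃, 2p}. Then there exists a constant C > 0, depending only on d, p, ε₃, c_d, such that for every integer n ≥ 1, every r ∈ (0,1], every finite index set J with |J| ≤ c_d·r^{−d}, every family of nonnegative weights (w_j)_{j∈J} with Σ_{j∈J} w_j ≤ 1, and every admissible pair of nets (Λ, Γ) for (n, r): inf over all (λ_j)_{j∈J} ∈ Λ^J and (γ_j)_{j∈J} ∈ Γ^J of [ (r/min_{j∈J} γ_j)^d·(Σ_{j∈J} λ_j)·n^{ε̃} + (Σ_{j∈J} λ_j^{−1}·γ_j^{−d/p}·w_j)^p · n^{−1} ] ≤ C · r^{−d} · n^{−1+ε₃}. -/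
open Set Finset

theorem statement17
    (d : ℕ) (hd : 1 ≤ d) (cd : ℝ) (hcd : 0 < cd)
    (p : ℝ) (hp : p ∈ Set.Ioo (0 : ℝ) (1/2)) (ε₃ : ℝ) (h2p : 2 * p ≤ ε₃) :
    ∃ C : ℝ, 0 < C ∧ ∀ εt : ℝ, 0 < εt → εt ≤ ε₃ →
      ∀ n : ℕ, 1 ≤ n → ∀ r : ℝ, r ∈ Set.Ioc (0 : ℝ) 1 →
      ∀ (ι : Type) (J : Finset ι) (hJne : J.Nonempty),
        (J.card : ℝ) ≤ cd * r ^ (-(d : ℝ)) →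
      ∀ w : ι → ℝ, (∀ j ∈ J, 0 ≤ w j) → (∑ j ∈ J, w j) ≤ 1 →
      ∀ Λ Γ : Set ℝ, AdmissibleNets n r Λ Γ →
      ∃ lam gam : ι → ℝ, (∀ j ∈ J, lam j ∈ Λ) ∧ (∀ j ∈ J, gam j ∈ Γ) ∧
        (r / J.inf' hJne gam) ^ d * (∑ j ∈ J, lam j) * (n : ℝ) ^ εt
          + (∑ j ∈ J, (lam j)⁻¹ * gam j ^ (-(d : ℝ) / p) * w j) ^ p * ((n : ℝ))⁻¹
        ≤ C * r ^ (-(d : ℝ)) * (n : ℝ) ^ (-1 + ε₃) := by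
  obtain ⟨hp0, -⟩ := hp
  refine ⟨3 * cd + 1, by positivity, ?_⟩
  intro εt _ hεt n hn r hr ι J hJne hcard w hw hwsum Λ Γ hnets
  obtain ⟨-, -, hΛ, -, hΓsub, hΓ⟩ := hnets
  have hr0 : 0 < r := hr.1
  have hn1 : (1 : ℝ) ≤ n := by exact_mod_cast hn
  have hn0 : (0 : ℝ) < n := by linarith
  -- The net `Γ` contains `r`, and `Λ` has a point of order `n⁻²`.
  obtain ⟨g, hgΓ, hrg, -⟩ := hΓ r ⟨hr0, le_rfl⟩
  have hgr : g ≤ r := (hΓsub hgΓ).2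
  obtain rfl : g = r := le_antisymm hgr hrg
  have hmem : 1 / (n : ℝ) ^ 2 ∈ Set.Ioc (0 : ℝ) (1 / (n : ℝ)) :=
    ⟨by positivity, one_div_le_one_div_of_le hn0 (by nlinarith)⟩
  obtain ⟨l, hlΛ, hl, hl'⟩ := hΛ _ hmem
  have hl0 : 0 < l := lt_of_lt_of_le hmem.1 hl
  have hl3 : l ≤ 3 * ((n : ℝ) ^ 2)⁻¹ := by
    refine hl'.trans (le_of_eq ?_)
    rw [one_div, div_eq_mul_inv]
    ring
  have hlinv : l⁻¹ ≤ (n : ℝ) ^ 2 := by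
    rw [one_div] at hl
    exact inv_le_of_inv_le₀ (by positivity) hl
  refine ⟨fun _ => l, fun _ => g, fun _ _ => hlΛ, fun _ _ => hgΓ, ?_⟩
  have hinf : J.inf' hJne (fun _ => g) = g := Finset.inf'_const hJne g
  rw [hinf, div_self hr0.ne', one_pow, one_mul, Finset.sum_const, nsmul_eq_mul, ← Finset.mul_sum]
  have hR : 0 < g ^ (-(d : ℝ)) := Real.rpow_pos_of_pos hr0 _
  have hsq : ((n : ℝ) ^ 2)⁻¹ ≤ (n : ℝ)⁻¹ := inv_anti₀ hn0 (by nlinarith)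
  have hsplit : (n : ℝ) ^ (-1 + ε₃) = (n : ℝ)⁻¹ * (n : ℝ) ^ ε₃ := by
    rw [Real.rpow_add hn0, Real.rpow_neg_one]
  have hfirst : (J.card : ℝ) * l * (n : ℝ) ^ εt
      ≤ 3 * cd * g ^ (-(d : ℝ)) * (n : ℝ) ^ (-1 + ε₃) := by
    calc (J.card : ℝ) * l * (n : ℝ) ^ εt
        ≤ (cd * g ^ (-(d : ℝ))) * (3 * (n : ℝ)⁻¹) * (n : ℝ) ^ ε₃ := by
          have h3 : l ≤ 3 * (n : ℝ)⁻¹ := by linarith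
          gcongr
      _ = _ := by rw [hsplit]; ring
  have hsecond : (l⁻¹ * g ^ (-(d : ℝ) / p) * ∑ j ∈ J, w j) ^ p * (n : ℝ)⁻¹
      ≤ g ^ (-(d : ℝ)) * (n : ℝ) ^ (-1 + ε₃) := by
    have hS : 0 ≤ ∑ j ∈ J, w j := Finset.sum_nonneg hw
    have hG : 0 < g ^ (-(d : ℝ) / p) := Real.rpow_pos_of_pos hr0 _
    calc (l⁻¹ * g ^ (-(d : ℝ) / p) * ∑ j ∈ J, w j) ^ p * (n : ℝ)⁻¹
        ≤ ((n : ℝ) ^ 2 * g ^ (-(d : ℝ) / p) * 1) ^ p * (n : ℝ)⁻¹ := by gcongr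
      _ = (n : ℝ) ^ (2 * p) * g ^ (-(d : ℝ)) * (n : ℝ)⁻¹ := by
          rw [mul_one, Real.mul_rpow (by positivity) hG.le, ← Real.rpow_mul hr0.le,
            div_mul_cancel₀ _ hp0.ne', ← Real.rpow_natCast, ← Real.rpow_mul hn0.le]
          norm_num
      _ ≤ (n : ℝ) ^ ε₃ * g ^ (-(d : ℝ)) * (n : ℝ)⁻¹ := by
          gcongr
      _ = _ := by rw [hsplit]; ring
  calc _ ≤ 3 * cd * g ^ (-(d : ℝ)) * (n : ℝ) ^ (-1 + ε₃)
        + g ^ (-(d : ℝ)) * (n : ℝ) ^ (-1 + ε₃) := add_le_add hfirst hsecond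
    _ = _ := by ring
end
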